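/- Let s : ℤ → Σ be a balanced sequence admitting at least one factorization s = p̃·xy·p with {x, y} = {a, b}. Let u, v ∈ L(s) be two factors of s. If u <_radix v, then μ_q(u)₁₂ ≺ μ_q(v)₁₂. -/

import Mathlib

open Polynomial

/-- The letter `a` is encoded by `false`, the letter `b` by `true`.
`μ_q` of a single letter. -/
noncomputable def muqLetter : Bool → Matrix (Fin 2) (Fin 2) (Polynomial ℤ)
  | false => !![X + X ^ 2, 1; X, 1]
  | true  => !![X + 2 * X ^ 2 + X ^ 3 + X ^ 4, 1 + X; X + X ^ 2, 1]

/-- The monoid homomorphism `μ_q : Σ* → M₂(ℤ[q])`, extended multiplicatively,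
with the empty word mapped to the identity matrix. -/
noncomputable def muq (w : List Bool) : Matrix (Fin 2) (Fin 2) (Polynomial ℤ) :=
  (w.map muqLetter).prod

/-- `u` is a factor of the biinfinite sequence `s`. -/
def IsFactor (s : ℤ → Bool) (u : List Bool) : Prop :=
  ∃ k : ℤ, u = (List.range u.length).map fun i => s (k + i)

/-- `s` is balanced: any two factors of the same length have numbers of
occurrences of each letter differing by at most 1. -/
def IsBalanced (s : ℤ → Bool) : Prop :=
  ∀ u v : List Bool, IsFactor s u → IsFactor s v → u.length = v.length →
    ∀ c : Bool, |(u.count c : ℤ) - (v.count c : ℤ)| ≤ 1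

/-- Radix order on binary words (with `a = false < b = true`). -/
def RadixLt (u v : List Bool) : Prop :=
  u.length < v.length ∨ (u.length = v.length ∧ List.Lex (· < ·) u v)

/-- `f ≺ g` iff `f ≠ g` and `g - f` has nonnegative integer coefficients. -/
def PolyPrec (f g : Polynomial ℤ) : Prop :=
  f ≠ g ∧ ∀ i : ℕ, 0 ≤ (g - f).coeff i

/-- A biinfinite sequence `s` admits a factorization `s = p̃·xy·p` with
`{x, y} = {a, b}` iff `s (-1) ≠ s 0` and `s n = s (-n - 1)` for all
`n ∈ ℤ ∖ {-1, 0}`. -/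
def HasCentralFactorization (s : ℤ → Bool) : Prop :=
  s (-1) ≠ s 0 ∧ ∀ n : ℤ, n ≠ -1 → n ≠ 0 → s n = s (-n - 1)

/-! ### Polynomials with nonnegative coefficients -/

/-- All coefficients are nonnegative. -/
def CoeffNonneg (f : ℤ[X]) : Prop := ∀ i, 0 ≤ f.coeff i

/-- All coefficients are nonnegative and at least one is nonzero. -/
def CoeffPos (f : ℤ[X]) : Prop := CoeffNonneg f ∧ f ≠ 0

lemma CoeffNonneg.zero : CoeffNonneg 0 := fun i => by simp

lemma CoeffNonneg.one : CoeffNonneg 1 := fun i => by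
  rw [coeff_one]; split_ifs <;> simp

lemma CoeffNonneg.X : CoeffNonneg X := fun i => by
  rw [coeff_X]; split_ifs <;> simp

lemma CoeffNonneg.add {f g : ℤ[X]} (hf : CoeffNonneg f) (hg : CoeffNonneg g) :
    CoeffNonneg (f + g) := fun i => by
  rw [coeff_add]; exact add_nonneg (hf i) (hg i)

lemma CoeffNonneg.mul {f g : ℤ[X]} (hf : CoeffNonneg f) (hg : CoeffNonneg g) :
    CoeffNonneg (f * g) := fun i => by
  rw [coeff_mul]; exact Finset.sum_nonneg fun x _ => mul_nonneg (hf _) (hg _)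

lemma CoeffNonneg.pow {f : ℤ[X]} (hf : CoeffNonneg f) (n : ℕ) : CoeffNonneg (f ^ n) := by
  induction n with
  | zero => simpa using CoeffNonneg.one
  | succ n ih => rw [pow_succ]; exact ih.mul hf

lemma CoeffNonneg.X_pow (n : ℕ) : CoeffNonneg (Polynomial.X ^ n) := CoeffNonneg.X.pow n

lemma CoeffPos.add_nonneg {f g : ℤ[X]} (hf : CoeffPos f) (hg : CoeffNonneg g) :
    CoeffPos (f + g) := by
  refine ⟨hf.1.add hg, fun h => hf.2 ?_⟩
  ext i
  have hi : f.coeff i + g.coeff i = 0 := by rw [← coeff_add, h, coeff_zero]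
  have := hf.1 i
  have := hg i
  rw [coeff_zero]
  omega

lemma CoeffNonneg.add_pos {f g : ℤ[X]} (hf : CoeffNonneg f) (hg : CoeffPos g) :
    CoeffPos (f + g) := by
  rw [add_comm]; exact hg.add_nonneg hf

lemma CoeffPos.mul {f g : ℤ[X]} (hf : CoeffPos f) (hg : CoeffPos g) : CoeffPos (f * g) :=
  ⟨hf.1.mul hg.1, mul_ne_zero hf.2 hg.2⟩

lemma CoeffPos.one : CoeffPos 1 := ⟨CoeffNonneg.one, one_ne_zero⟩

lemma CoeffPos.X_pow (n : ℕ) : CoeffPos (Polynomial.X ^ n) :=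
  ⟨CoeffNonneg.X_pow n, pow_ne_zero n X_ne_zero⟩

lemma CoeffPos.X : CoeffPos X := ⟨CoeffNonneg.X, X_ne_zero⟩

lemma polyPrec_of_coeffPos_sub {f g : ℤ[X]} (h : CoeffPos (g - f)) : PolyPrec f g :=
  ⟨fun e => h.2 (by rw [e, sub_self]), h.1⟩

/-! ### Entries of `muq` -/

lemma muq_append (u v : List Bool) : muq (u ++ v) = muq u * muq v := by
  simp [muq]

lemma muq_cons (c : Bool) (v : List Bool) : muq (c :: v) = muqLetter c * muq v := by
  simp [muq]

lemma muq_nil : muq [] = 1 := by simp [muq]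

lemma muq_singleton (c : Bool) : muq [c] = muqLetter c := by simp [muq]

lemma muq_append_singleton_apply (w : List Bool) (c : Bool) (i j : Fin 2) :
    muq (w ++ [c]) i j = muq w i 0 * muqLetter c 0 j + muq w i 1 * muqLetter c 1 j := by
  rw [muq_append, muq_singleton, Matrix.mul_apply, Fin.sum_univ_two]

lemma muqLetter_nonneg (c : Bool) (i j : Fin 2) : CoeffNonneg (muqLetter c i j) := by
  have hX := CoeffNonneg.X
  have h1 := CoeffNonneg.one
  cases c <;> fin_cases i <;> fin_cases j <;> simp only [muqLetter, Matrix.of_apply,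
    Matrix.cons_val', Matrix.cons_val_zero, Matrix.cons_val_one, Matrix.cons_val_fin_one,
    Fin.zero_eta, Fin.mk_one, Fin.isValue]
  · exact hX.add (hX.pow 2)
  · exact h1
  · exact hX
  · exact h1
  · rw [two_mul]
    exact ((hX.add ((hX.pow 2).add (hX.pow 2))).add (hX.pow 3)).add (hX.pow 4)
  · exact h1.add hX
  · exact hX.add (hX.pow 2)
  · exact h1

lemma muq_nonneg (w : List Bool) (i j : Fin 2) : CoeffNonneg (muq w i j) := by
  induction w generalizing i j with
  | nil =>
    rw [muq_nil, Matrix.one_apply]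
    split_ifs
    exacts [CoeffNonneg.one, CoeffNonneg.zero]
  | cons c w ih =>
    rw [muq_cons, Matrix.mul_apply, Fin.sum_univ_two]
    exact ((muqLetter_nonneg c i 0).mul (ih 0 j)).add ((muqLetter_nonneg c i 1).mul (ih 1 j))

lemma muq_append_false_sub (w : List Bool) (i : Fin 2) :
    muq (w ++ [false]) i 0 - X * muq (w ++ [false]) i 1 = X ^ 2 * muq w i 0 := by
  simp only [muq_append_singleton_apply, muqLetter, Matrix.of_apply, Matrix.cons_val',
    Matrix.cons_val_zero, Matrix.cons_val_one, Matrix.cons_val_fin_one]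
  ring

lemma muq_append_true_sub (w : List Bool) (i : Fin 2) :
    muq (w ++ [true]) i 0 - X * muq (w ++ [true]) i 1 =
      (X ^ 2 + X ^ 3 + X ^ 4) * muq w i 0 + X ^ 2 * muq w i 1 := by
  simp only [muq_append_singleton_apply, muqLetter, Matrix.of_apply, Matrix.cons_val',
    Matrix.cons_val_zero, Matrix.cons_val_one, Matrix.cons_val_fin_one]
  ring

lemma X_two_three_four_pos : CoeffPos (X ^ 2 + X ^ 3 + X ^ 4) :=
  ((CoeffPos.X_pow 2).add_nonneg (CoeffNonneg.X_pow 3)).add_nonneg (CoeffNonneg.X_pow 4)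

lemma muq_zero_zero_sub_pos (w : List Bool) : CoeffPos (muq w 0 0 - X * muq w 0 1) := by
  induction w using List.reverseRecOn with
  | nil => simpa [muq_nil] using CoeffPos.one
  | append_singleton w c ih =>
    have h : CoeffPos (muq w 0 0) := by
      simpa using ih.add_nonneg (CoeffNonneg.X.mul (muq_nonneg w 0 1))
    cases c
    · rw [muq_append_false_sub]
      exact (CoeffPos.X_pow 2).mul h
    · rw [muq_append_true_sub]
      exact (X_two_three_four_pos.mul h).add_nonneg ((CoeffNonneg.X_pow 2).mul (muq_nonneg w 0 1))

lemma muq_zero_zero_pos (w : List Bool) : CoeffPos (muq w 0 0) := by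
  simpa using (muq_zero_zero_sub_pos w).add_nonneg (CoeffNonneg.X.mul (muq_nonneg w 0 1))

lemma muq_one_one_pos (w : List Bool) : CoeffPos (muq w 1 1) := by
  induction w using List.reverseRecOn with
  | nil => simpa [muq_nil] using CoeffPos.one
  | append_singleton w c ih =>
    rw [muq_append_singleton_apply]
    have : muqLetter c 1 1 = 1 := by cases c <;> simp [muqLetter]
    rw [this, mul_one]
    exact ((muq_nonneg w 1 0).mul (muqLetter_nonneg c 0 1)).add_pos ih

lemma muq_append_zero_one_nonneg (u v : List Bool) :
    CoeffNonneg (muq (u ++ v) 0 1 - muq u 0 1) := by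
  induction v using List.reverseRecOn with
  | nil => simpa using CoeffNonneg.zero
  | append_singleton v c ih =>
    rw [← List.append_assoc, muq_append_singleton_apply]
    have : muqLetter c 1 1 = 1 := by cases c <;> simp [muqLetter]
    rw [this, mul_one, add_sub_assoc]
    exact ((muq_nonneg _ 0 0).mul (muqLetter_nonneg c 0 1)).add ih

lemma muq_zero_one_pos {v : List Bool} (hv : v ≠ []) : CoeffPos (muq v 0 1) := by
  obtain ⟨w, c, rfl⟩ : ∃ w c, v = w ++ [c] := ⟨_, _, (List.dropLast_append_getLast hv).symm⟩
  rw [muq_append_singleton_apply]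
  have h : CoeffPos (muqLetter c 0 1) := by
    cases c
    · simpa [muqLetter] using CoeffPos.one
    · simpa [muqLetter] using CoeffPos.one.add_nonneg CoeffNonneg.X
  exact ((muq_zero_zero_pos w).mul h).add_nonneg
    ((muq_nonneg w 0 1).mul (muqLetter_nonneg c 1 1))

/-! ### The elementary moves -/

lemma muq_append_true_sub_append_false_pos (w : List Bool) :
    CoeffPos (muq (w ++ [true]) 0 1 - muq (w ++ [false]) 0 1) := by
  have h : muq (w ++ [true]) 0 1 - muq (w ++ [false]) 0 1 = X * muq w 0 0 := by
    simp only [muq_append_singleton_apply, muqLetter, Matrix.of_apply, Matrix.cons_val',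
      Matrix.cons_val_zero, Matrix.cons_val_one, Matrix.cons_val_fin_one]
    ring
  rw [h]
  exact CoeffPos.X.mul (muq_zero_zero_pos w)

/-- The matrix to which the commutator `μ_q(ba) - μ_q(ab)` is proportional. -/
noncomputable def skewMatrix : Matrix (Fin 2) (Fin 2) ℤ[X] := !![0, 1; -X, 0]

lemma muqLetter_mul_skewMatrix_mul (c : Bool) :
    ∃ n : ℕ, muqLetter c * skewMatrix * muqLetter c = (X ^ n : ℤ[X]) • skewMatrix := by
  cases c
  · refine ⟨2, ?_⟩
    ext1 i j
    fin_cases i <;> fin_cases j <;>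
      simp [muqLetter, skewMatrix, Matrix.mul_apply, Fin.sum_univ_two] <;> ring
  · refine ⟨4, ?_⟩
    ext1 i j
    fin_cases i <;> fin_cases j <;>
      simp [muqLetter, skewMatrix, Matrix.mul_apply, Fin.sum_univ_two] <;> ring

lemma muq_mul_skewMatrix_mul_reverse (w : List Bool) :
    ∃ n : ℕ, muq w * skewMatrix * muq w.reverse = (X ^ n : ℤ[X]) • skewMatrix := by
  induction w with
  | nil => exact ⟨0, by simp [muq_nil]⟩
  | cons c w ih =>
    obtain ⟨n, hn⟩ := ih
    obtain ⟨m, hm⟩ := muqLetter_mul_skewMatrix_mul c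
    refine ⟨n + m, ?_⟩
    rw [List.reverse_cons, muq_append, muq_singleton, muq_cons,
      show muqLetter c * muq w * skewMatrix * (muq w.reverse * muqLetter c) =
        muqLetter c * (muq w * skewMatrix * muq w.reverse) * muqLetter c by
        simp only [Matrix.mul_assoc], hn, Matrix.mul_smul, Matrix.smul_mul, hm, smul_smul, pow_add]

lemma muq_true_false_sub_false_true :
    muq [true, false] - muq [false, true] = (X + X ^ 4 : ℤ[X]) • skewMatrix := by
  ext1 i j
  fin_cases i <;> fin_cases j <;>
    simp [muq, muqLetter, skewMatrix] <;> ring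

lemma muq_swap_sub (x y : List Bool) :
    muq (x ++ [true, false] ++ y) - muq (x ++ [false, true] ++ y) =
      (X + X ^ 4 : ℤ[X]) • (muq x * skewMatrix * muq y) := by
  simp only [muq_append]
  rw [← Matrix.sub_mul, ← Matrix.mul_sub, muq_true_false_sub_false_true, Matrix.mul_smul,
    Matrix.smul_mul]

lemma X_add_X_pow_four_pos : CoeffPos (X + X ^ 4) :=
  CoeffPos.X.add_nonneg (CoeffNonneg.X_pow 4)

lemma muq_swap_right_pos (w r : List Bool) :
    CoeffPos (muq (w ++ [true, false] ++ (w.reverse ++ r)) 0 1 -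
      muq (w ++ [false, true] ++ (w.reverse ++ r)) 0 1) := by
  obtain ⟨n, hn⟩ := muq_mul_skewMatrix_mul_reverse w
  have h := congrFun₂ (muq_swap_sub w (w.reverse ++ r)) 0 1
  rw [muq_append w.reverse, ← Matrix.mul_assoc, hn] at h
  rw [Matrix.sub_apply] at h
  rw [h]
  have e : ((X + X ^ 4 : ℤ[X]) • ((X ^ n : ℤ[X]) • skewMatrix * muq r)) 0 1 =
      (X + X ^ 4) * (X ^ n * muq r 1 1) := by
    simp only [Matrix.smul_apply, Matrix.mul_apply, Fin.sum_univ_two, smul_eq_mul]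
    simp [skewMatrix]
  rw [e]
  exact X_add_X_pow_four_pos.mul ((CoeffPos.X_pow n).mul (muq_one_one_pos r))

lemma muq_swap_left_pos (r w : List Bool) :
    CoeffPos (muq (r ++ w ++ [true, false] ++ w.reverse) 0 1 -
      muq (r ++ w ++ [false, true] ++ w.reverse) 0 1) := by
  obtain ⟨n, hn⟩ := muq_mul_skewMatrix_mul_reverse w
  have h := congrFun₂ (muq_swap_sub (r ++ w) w.reverse) 0 1
  rw [muq_append r, Matrix.mul_assoc, Matrix.mul_assoc, ← Matrix.mul_assoc (muq w), hn] at h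
  rw [Matrix.sub_apply] at h
  rw [h]
  have e : ((X + X ^ 4 : ℤ[X]) • (muq r * ((X ^ n : ℤ[X]) • skewMatrix))) 0 1 =
      (X + X ^ 4) * (X ^ n * muq r 0 0) := by
    simp only [Matrix.smul_apply, Matrix.mul_apply, Fin.sum_univ_two, smul_eq_mul]
    simp [skewMatrix, mul_comm]
  rw [e]
  exact X_add_X_pow_four_pos.mul ((CoeffPos.X_pow n).mul (muq_zero_zero_pos r))

/-! ### Comparison of words of different lengths -/

lemma muq_row_zero_pos (w : List Bool) :
    CoeffPos ((X + X ^ 2) * muq w 0 0 + muq w 1 0 - (X ^ 2 + X ^ 3 + X ^ 4) * muq w 0 1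
      - X * muq w 1 1) := by
  induction w using List.reverseRecOn with
  | nil =>
    have : CoeffPos ((X : ℤ[X]) ^ 2) := CoeffPos.X_pow 2
    simpa [muq_nil] using this
  | append_singleton w c _ =>
    have h : (X + X ^ 2) * muq (w ++ [c]) 0 0 + muq (w ++ [c]) 1 0
        - (X ^ 2 + X ^ 3 + X ^ 4) * muq (w ++ [c]) 0 1 - X * muq (w ++ [c]) 1 1 =
        X * ((1 + X) * muq (w ++ [c]) 0 0 - (X + X ^ 2 + X ^ 3) * muq (w ++ [c]) 0 1) +
        (muq (w ++ [c]) 1 0 - X * muq (w ++ [c]) 1 1) := by ring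
    have hX := CoeffNonneg.X_pow
    have hx := muq_zero_zero_pos w
    rw [h]
    refine CoeffPos.add_nonneg (CoeffPos.X.mul ?_) ?_
    · cases c
      · have e : (1 + X) * muq (w ++ [false]) 0 0
            - (X + X ^ 2 + X ^ 3) * muq (w ++ [false]) 0 1 =
            X ^ 2 * (muq w 0 0 - X * muq w 0 1) := by
          simp only [muq_append_singleton_apply, muqLetter, Matrix.of_apply, Matrix.cons_val',
            Matrix.cons_val_zero, Matrix.cons_val_one, Matrix.cons_val_fin_one]
          ring
        rw [e]
        exact (CoeffPos.X_pow 2).mul (muq_zero_zero_sub_pos w)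
      · have e : (1 + X) * muq (w ++ [true]) 0 0
            - (X + X ^ 2 + X ^ 3) * muq (w ++ [true]) 0 1 =
            (X ^ 2 + X ^ 3 + X ^ 4 + X ^ 5) * muq w 0 0 + X ^ 2 * muq w 0 1 := by
          simp only [muq_append_singleton_apply, muqLetter, Matrix.of_apply, Matrix.cons_val',
            Matrix.cons_val_zero, Matrix.cons_val_one, Matrix.cons_val_fin_one]
          ring
        rw [e]
        exact ((X_two_three_four_pos.add_nonneg (hX 5)).mul hx).add_nonneg
          ((hX 2).mul (muq_nonneg w 0 1))
    · cases c
      · rw [muq_append_false_sub]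
        exact (hX 2).mul (muq_nonneg w 1 0)
      · rw [muq_append_true_sub]
        exact (X_two_three_four_pos.1.mul (muq_nonneg w 1 0)).add ((hX 2).mul (muq_nonneg w 1 1))

lemma muq_cons_append_sub_cons_pos (w : List Bool) (c : Bool) :
    CoeffPos (muq (false :: w ++ [c]) 0 1 - muq (true :: w) 0 1) := by
  have h : CoeffPos (muq (false :: w ++ [false]) 0 1 - muq (true :: w) 0 1) := by
    convert! muq_row_zero_pos w using 1
    simp only [muq_append_singleton_apply, muq_cons, muqLetter, Matrix.mul_apply,
      Fin.sum_univ_two, Matrix.of_apply, Matrix.cons_val',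
      Matrix.cons_val_zero, Matrix.cons_val_one, Matrix.cons_val_fin_one]
    ring
  cases c
  · exact h
  · simpa using (muq_append_true_sub_append_false_pos (false :: w)).add_nonneg h.1

/-! ### Lexicographic order on binary words -/

lemma List.exists_first_difference {α : Type*} {u v : List α} (hl : u.length = v.length)
    (h : u ≠ v) : ∃ q c d u' v', u = q ++ c :: u' ∧ v = q ++ d :: v' ∧ c ≠ d := by
  induction u generalizing v with
  | nil => exact absurd (List.length_eq_zero_iff.1 hl.symm).symm h
  | cons a u ih =>
    cases v with
    | nil => simp at hl
    | cons b v =>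
      by_cases hab : a = b
      · subst hab
        obtain ⟨q, c, d, u', v', rfl, rfl, hcd⟩ := ih (by simpa using hl) (by simpa using h)
        exact ⟨a :: q, c, d, u', v', rfl, rfl, hcd⟩
      · exact ⟨[], a, b, u, v, rfl, rfl, hab⟩

lemma List.append_lt_append_iff_left {α : Type*} [LinearOrder α] (q u v : List α) :
    q ++ u < q ++ v ↔ u < v := by
  induction q with
  | nil => rfl
  | cons a q ih => simp [ih]

lemma false_cons_lt_true_cons (u v : List Bool) : false :: u < true :: v := by
  simp [List.cons_lt_cons_iff]

lemma exists_of_lt_of_length_eq {u v : List Bool} (hl : u.length = v.length) (h : u < v) :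
    ∃ q u' v', u = q ++ false :: u' ∧ v = q ++ true :: v' := by
  obtain ⟨q, c, d, u', v', rfl, rfl, hcd⟩ := List.exists_first_difference hl h.ne
  cases c <;> cases d
  · exact absurd rfl hcd
  · exact ⟨q, u', v', rfl, rfl⟩
  · rw [List.append_lt_append_iff_left] at h
    exact absurd h (false_cons_lt_true_cons v' u').asymm
  · exact absurd rfl hcd

lemma exists_append_of_between {x A B v : List Bool} (h1 : x ++ A < v) (h2 : v < x ++ B) :
    ∃ V, v = x ++ V ∧ A < V ∧ V < B := by
  induction x generalizing v with
  | nil => exact ⟨v, rfl, h1, h2⟩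
  | cons a x ih =>
    cases v with
    | nil => simp at h1
    | cons b v =>
      simp only [List.cons_append, List.cons_lt_cons_iff] at h1 h2
      rcases h1 with h1 | ⟨rfl, h1⟩
      · rcases h2 with h2 | ⟨rfl, _⟩
        · exact absurd h1 h2.asymm
        · exact absurd h1 (lt_irrefl _)
      · rcases h2 with h2 | ⟨_, h2⟩
        · exact absurd h2 (lt_irrefl _)
        · obtain ⟨V, rfl, hA, hB⟩ := ih h1 h2
          exact ⟨V, rfl, hA, hB⟩

/-! ### Central balanced languages -/

/-- The prefix of length `n` of a right-infinite word. -/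
def wordPrefix (p : ℕ → Bool) (n : ℕ) : List Bool := (List.range n).map p

@[simp] lemma length_wordPrefix (p : ℕ → Bool) (n : ℕ) : (wordPrefix p n).length = n := by
  simp [wordPrefix]

@[simp] lemma wordPrefix_zero (p : ℕ → Bool) : wordPrefix p 0 = [] := rfl

lemma wordPrefix_succ (p : ℕ → Bool) (n : ℕ) :
    wordPrefix p (n + 1) = wordPrefix p n ++ [p n] := by
  simp [wordPrefix, List.range_succ]

lemma exists_wordPrefix_add (p : ℕ → Bool) (m n : ℕ) :
    ∃ r, wordPrefix p (m + n) = wordPrefix p m ++ r := by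
  induction n with
  | zero => exact ⟨[], by simp⟩
  | succ n ih =>
    obtain ⟨r, hr⟩ := ih
    exact ⟨r ++ [p (m + n)], by rw [← add_assoc, wordPrefix_succ, hr, List.append_assoc]⟩

/-- A balanced set of words, closed under factors and reversal, which contains the factors
of `p̃·ab·p`. -/
structure IsCentralLanguage (F : List Bool → Prop) (p : ℕ → Bool) : Prop where
  of_infix : ∀ x y z, F (x ++ y ++ z) → F y
  reverse : ∀ x, F x → F x.reverse
  balanced : ∀ t, F (false :: t ++ [false]) → ¬ F (true :: t ++ [true])
  central : ∀ i j, F ((wordPrefix p i).reverse ++ [false, true] ++ wordPrefix p j)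

namespace IsCentralLanguage

variable {F : List Bool → Prop} {p : ℕ → Bool}

lemma of_prefix (h : IsCentralLanguage F p) {x y : List Bool} (hx : F (x ++ y)) : F x :=
  h.of_infix [] x y (by simpa using hx)

lemma of_suffix (h : IsCentralLanguage F p) {x y : List Bool} (hx : F (x ++ y)) : F y :=
  h.of_infix x y [] (by simpa using hx)

lemma reverse_append_false (h : IsCentralLanguage F p) (n : ℕ) :
    F ((wordPrefix p n).reverse ++ [false]) := by
  have := h.central n 0
  exact h.of_prefix (y := [true]) (by simpa using this)

lemma true_cons (h : IsCentralLanguage F p) (n : ℕ) : F (true :: wordPrefix p n) := by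
  have := h.central 0 n
  exact h.of_suffix (x := [false]) (by simpa using this)

lemma cons (h : IsCentralLanguage F p) (c : Bool) (n : ℕ) : F (c :: wordPrefix p n) := by
  cases c
  · simpa using h.reverse _ (h.reverse_append_false n)
  · exact h.true_cons n

lemma reverse_append (h : IsCentralLanguage F p) (c : Bool) (n : ℕ) :
    F ((wordPrefix p n).reverse ++ [c]) := by
  simpa using h.reverse _ (h.cons c n)

lemma central_swap (h : IsCentralLanguage F p) (i j : ℕ) :
    F ((wordPrefix p i).reverse ++ [true, false] ++ wordPrefix p j) := by
  simpa using h.reverse _ (h.central j i)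

lemma le_of_true_cons (h : IsCentralLanguage F p) {t : List Bool} (ht : F (true :: t)) :
    t ≤ wordPrefix p t.length := by
  by_contra! hlt
  obtain ⟨q, u, v, hu, hv⟩ := exists_of_lt_of_length_eq (by simp) hlt
  have h1 := h.cons false t.length
  rw [hu] at h1
  rw [hv] at ht
  exact h.balanced q (h.of_prefix (y := u) (by simpa using h1))
    (h.of_prefix (y := v) (by simpa using ht))

lemma le_of_false_cons (h : IsCentralLanguage F p) {t : List Bool} (ht : F (false :: t)) :
    wordPrefix p t.length ≤ t := by
  by_contra! hlt
  obtain ⟨q, u, v, hu, hv⟩ := exists_of_lt_of_length_eq (by simp) hlt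
  have h1 := h.cons true t.length
  rw [hv] at h1
  rw [hu] at ht
  exact h.balanced q (h.of_prefix (y := u) (by simpa using ht))
    (h.of_prefix (y := v) (by simpa using h1))

lemma eq_of_right_special (h : IsCentralLanguage F p) {u : List Bool}
    (hu : ∀ c, F (u ++ [c])) : u = (wordPrefix p u.length).reverse := by
  by_contra hne
  obtain ⟨q, c, d, a, b, ha, hb, hcd⟩ :=
    List.exists_first_difference (u := u.reverse) (v := wordPrefix p u.length) (by simp)
      (fun e => hne (by rw [← e, List.reverse_reverse]))
  have h1 (e : Bool) : F (e :: q ++ [c]) := by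
    have := h.reverse _ (hu e)
    rw [List.reverse_append, ha] at this
    exact h.of_prefix (y := a) (by simpa using this)
  have h2 (e : Bool) : F (e :: q ++ [d]) := by
    have := h.cons e u.length
    rw [hb] at this
    exact h.of_prefix (y := b) (by simpa using this)
  cases c <;> cases d
  · exact hcd rfl
  · exact h.balanced q (h1 _) (h2 _)
  · exact h.balanced q (h2 _) (h1 _)
  · exact hcd rfl

/-- Extending a word `x·b·p_n` on the right. -/
lemma append_cases (h : IsCentralLanguage F p) {x : List Bool} {n : ℕ} {c : Bool}
    (hF : F (x ++ true :: wordPrefix p n ++ [c]))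
    (hn : F (x ++ true :: wordPrefix p (n + 1))) :
    x ++ true :: wordPrefix p n ++ [c] = x ++ true :: wordPrefix p (n + 1) ∨
      ∃ i, x ++ true :: wordPrefix p n ++ [c] = (wordPrefix p i).reverse ++ [false] := by
  by_cases hc : c = p n
  · left
    rw [hc, wordPrefix_succ]
    simp
  · right
    have hle := h.le_of_true_cons (t := wordPrefix p n ++ [c])
      (h.of_suffix (x := x) (by simpa using hF))
    rw [List.length_append, length_wordPrefix, List.length_singleton, wordPrefix_succ,
      ← not_lt, List.append_lt_append_iff_left] at hle
    have hcf : c = false ∧ p n = true := by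
      revert hc hle
      cases c <;> cases p n <;> simp [List.cons_lt_cons_iff]
    rw [wordPrefix_succ, hcf.2] at hn
    rw [hcf.1] at hF ⊢
    refine ⟨_, congrArg (· ++ [false])
      (h.eq_of_right_special (u := x ++ true :: wordPrefix p n) fun e => ?_)⟩
    cases e
    · exact hF
    · simpa using hn

lemma classification (h : IsCentralLanguage F p) {u : List Bool} (hu : F u) :
    u = [] ∨ (∃ i j, u = (wordPrefix p i).reverse ++ [false, true] ++ wordPrefix p j) ∨
      (∃ i, u = (wordPrefix p i).reverse ++ [false]) ∨ ∃ j, u = true :: wordPrefix p j := by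
  induction u using List.reverseRecOn with
  | nil => exact Or.inl rfl
  | append_singleton u c ih =>
    right
    rcases ih (h.of_prefix hu) with rfl | ⟨i, j, rfl⟩ | ⟨i, rfl⟩ | ⟨j, rfl⟩
    · cases c
      · exact Or.inr (Or.inl ⟨0, rfl⟩)
      · exact Or.inr (Or.inr ⟨0, rfl⟩)
    · have e (l : List Bool) : (wordPrefix p i).reverse ++ [false, true] ++ l =
          (wordPrefix p i).reverse ++ [false] ++ true :: l := by simp
      have hc := h.central i (j + 1)
      rw [e] at hu hc ⊢
      rcases h.append_cases hu hc with h1 | h1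
      · exact Or.inl ⟨i, j + 1, by rw [h1, e]⟩
      · exact Or.inr (Or.inl h1)
    · cases c
      · right; left
        refine ⟨_, congrArg (· ++ [false])
          (h.eq_of_right_special (u := (wordPrefix p i).reverse ++ [false]) fun e => ?_)⟩
        cases e
        · exact hu
        · simpa using h.central i 0
      · exact Or.inl ⟨i, 0, by simp⟩
    · rcases h.append_cases (x := []) hu (h.true_cons (j + 1)) with h1 | h1
      · exact Or.inr (Or.inr ⟨j + 1, h1⟩)
      · exact Or.inr (Or.inl h1)

lemma muq_swap_pos (p : ℕ → Bool) (i j : ℕ) :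
    CoeffPos (muq ((wordPrefix p i).reverse ++ [true, false] ++ wordPrefix p j) 0 1 -
      muq ((wordPrefix p i).reverse ++ [false, true] ++ wordPrefix p j) 0 1) := by
  rcases le_total i j with hij | hij
  · obtain ⟨k, rfl⟩ := Nat.exists_eq_add_of_le hij
    obtain ⟨r, hr⟩ := exists_wordPrefix_add p i k
    rw [hr]
    simpa using muq_swap_right_pos (wordPrefix p i).reverse r
  · obtain ⟨k, rfl⟩ := Nat.exists_eq_add_of_le hij
    obtain ⟨r, hr⟩ := exists_wordPrefix_add p j k
    rw [hr]
    simpa using muq_swap_left_pos r.reverse (wordPrefix p j).reverse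

lemma exists_succ (h : IsCentralLanguage F p) {u v : List Bool} (hu : F u) (hv : F v)
    (hl : u.length = v.length) (huv : u < v) :
    ∃ w, F w ∧ w.length = v.length ∧ u < w ∧ w ≤ v ∧
      CoeffPos (muq w 0 1 - muq u 0 1) := by
  rcases h.classification hu with rfl | ⟨i, j, rfl⟩ | ⟨i, rfl⟩ | ⟨j, rfl⟩
  · rw [List.length_eq_zero_iff.1 hl.symm] at huv
    exact absurd huv (lt_irrefl _)
  · refine ⟨_, h.central_swap i j, by simpa using hl, ?_, ?_, muq_swap_pos p i j⟩
    · rw [List.append_assoc, List.append_assoc, List.append_lt_append_iff_left]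
      exact false_cons_lt_true_cons _ _
    · by_contra! hlt
      rw [List.append_assoc] at huv hlt
      obtain ⟨V, rfl, hA, hB⟩ := exists_append_of_between huv hlt
      have hV := h.of_suffix hv
      simp only [List.length_append, List.length_reverse, length_wordPrefix,
        add_assoc, Nat.add_left_cancel_iff] at hl
      match V, hl with
      | [c], hl => simp at hl; omega
      | c :: d :: t, hl =>
        have ht : t.length = j := by
          simp only [List.length_cons, List.length_nil] at hl
          omega
        cases c <;> cases d <;> simp [List.cons_lt_cons_iff, Bool.lt_iff] at hA hB
        · have := h.le_of_true_cons (h.of_suffix (x := [false]) hV)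
          rw [ht] at this
          exact hA.not_ge this
        · have := h.le_of_false_cons (h.of_suffix (x := [true]) hV)
          rw [ht] at this
          exact hB.not_ge this
  · refine ⟨_, h.reverse_append true i, by simpa using hl, ?_, ?_,
      muq_append_true_sub_append_false_pos _⟩
    · rw [List.append_lt_append_iff_left]
      exact false_cons_lt_true_cons _ _
    · by_contra! hlt
      obtain ⟨V, rfl, hA, hB⟩ := exists_append_of_between huv hlt
      match V with
      | [] => simp at hA
      | c :: t =>
        have ht : t = [] := by simpa using hl
        subst ht
        cases c <;> simp [List.cons_lt_cons_iff] at hA hB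
  · match v, hl with
    | c :: t, hl =>
      have ht : t.length = j := by simpa using hl.symm
      cases c
      · exact absurd huv (false_cons_lt_true_cons _ _).asymm
      · have := h.le_of_true_cons hv
        rw [ht] at this
        simp only [List.cons_lt_cons_iff, lt_irrefl, true_and, false_or] at huv
        exact absurd huv this.not_gt

lemma muq_sub_pos_of_lt (h : IsCentralLanguage F p) {u v : List Bool} (hu : F u) (hv : F v)
    (hl : u.length = v.length) (huv : u < v) : CoeffPos (muq v 0 1 - muq u 0 1) := by
  have hwf : {w : List Bool | w.length = v.length}.WellFoundedOn (· > ·) :=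
    (List.finite_length_eq Bool v.length).wellFoundedOn
  refine hwf.induction (P := fun u => F u → u < v → CoeffPos (muq v 0 1 - muq u 0 1)) hl
    (fun u hl ih hu huv => ?_) hu huv
  obtain ⟨w, hw, hwl, huw, hwv, hpos⟩ := h.exists_succ hu hv hl huv
  rcases hwv.eq_or_lt with rfl | hwv
  · exact hpos
  · simpa using (ih w hwl huw hw hwv).add_nonneg hpos.1

lemma muq_sub_nonneg_of_le (h : IsCentralLanguage F p) {u v : List Bool} (hu : F u) (hv : F v)
    (hl : u.length = v.length) (huv : u ≤ v) : CoeffNonneg (muq v 0 1 - muq u 0 1) := by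
  rcases huv.eq_or_lt with rfl | huv
  · simpa using CoeffNonneg.zero
  · exact (h.muq_sub_pos_of_lt hu hv hl huv).1

lemma le_true_cons (h : IsCentralLanguage F p) {n : ℕ} {u : List Bool} (hu : F u)
    (hl : u.length = n + 1) : u ≤ true :: wordPrefix p n := by
  match u, hl with
  | false :: t, _ => exact (false_cons_lt_true_cons _ _).le
  | true :: t, hl =>
    have ht : t.length = n := by simpa using hl
    have := h.le_of_true_cons hu
    rw [ht] at this
    rw [← not_lt] at this ⊢
    simpa [List.cons_lt_cons_iff] using this

lemma false_cons_le (h : IsCentralLanguage F p) {n : ℕ} {u : List Bool} (hu : F u)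
    (hl : u.length = n + 1) : false :: wordPrefix p n ≤ u := by
  match u, hl with
  | true :: t, _ => exact (false_cons_lt_true_cons _ _).le
  | false :: t, hl =>
    have ht : t.length = n := by simpa using hl
    have := h.le_of_false_cons hu
    rw [ht] at this
    rw [← not_lt] at this ⊢
    simpa [List.cons_lt_cons_iff] using this

lemma muq_sub_pos_of_length_lt (h : IsCentralLanguage F p) {u v : List Bool} (hu : F u)
    (hv : F v) (hl : u.length < v.length) : CoeffPos (muq v 0 1 - muq u 0 1) := by
  rcases Nat.eq_zero_or_eq_succ_pred u.length with h0 | hn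
  · rw [List.length_eq_zero_iff.1 h0] at hl ⊢
    simpa [muq_nil] using muq_zero_one_pos (List.length_pos_iff.1 hl)
  · set n := u.length.pred
    have hvl : (v.take (n + 2)).length = n + 1 + 1 := by
      rw [List.length_take]
      omega
    have hvt : F (v.take (n + 2)) := h.of_prefix (y := v.drop (n + 2)) (by simpa using hv)
    have h1 := h.muq_sub_nonneg_of_le hu (h.true_cons n) (by simpa using hn)
      (h.le_true_cons hu hn)
    have h2 := h.muq_sub_nonneg_of_le (h.cons false (n + 1)) hvt (by simpa using hvl.symm)
      (h.false_cons_le hvt hvl)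
    have h3 := muq_append_zero_one_nonneg (v.take (n + 2)) (v.drop (n + 2))
    rw [List.take_append_drop] at h3
    have h4 := muq_cons_append_sub_cons_pos (wordPrefix p n) (p n)
    rw [List.cons_append, ← wordPrefix_succ] at h4
    convert! ((h4.add_nonneg h1).add_nonneg h2).add_nonneg h3 using 1
    ring

end IsCentralLanguage

/-! ### The language of a central balanced sequence -/

lemma isFactor_iff_getElem (s : ℤ → Bool) (u : List Bool) :
    IsFactor s u ↔ ∃ k : ℤ, ∀ (i : ℕ) (hi : i < u.length), u[i] = s (k + i) := by
  refine exists_congr fun k => ⟨fun h i hi => ?_, fun h => List.ext_getElem (by simp) ?_⟩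
  · have := List.getElem_of_eq h hi
    simpa [← List.map_eq_flatMap] using this
  · intro i h1 _
    simpa [← List.map_eq_flatMap] using h i h1

lemma IsFactor.of_infix {s : ℤ → Bool} {x y z : List Bool} (h : IsFactor s (x ++ y ++ z)) :
    IsFactor s y := by
  rw [isFactor_iff_getElem] at h ⊢
  obtain ⟨k, hk⟩ := h
  refine ⟨k + x.length, fun i hi => ?_⟩
  have := hk (x.length + i) (by simp; omega)
  simp only [List.append_assoc] at this
  rw [List.getElem_append_right (by omega), List.getElem_append_left (by omega)] at this
  simp only [Nat.add_sub_cancel_left] at this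
  rw [this]
  push_cast
  rw [add_assoc]

lemma isFactor_central {s : ℤ → Bool} (hfac : HasCentralFactorization s) (i j : ℕ) :
    IsFactor s ((wordPrefix (fun n => s (n + 1)) i).reverse ++ [s (-1), s 0] ++
      wordPrefix (fun n => s (n + 1)) j) := by
  rw [isFactor_iff_getElem]
  refine ⟨-1 - i, fun m hm => ?_⟩
  simp only [List.length_append, List.length_reverse, length_wordPrefix, List.length_cons,
    List.length_nil] at hm
  simp only [List.append_assoc]
  rcases lt_or_ge m i with h1 | h1
  · rw [List.getElem_append_left (by simpa using h1)]
    simp only [List.getElem_reverse, wordPrefix, List.getElem_map, List.getElem_range,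
      List.length_map, List.length_range]
    rw [hfac.2 _ (by omega) (by omega)]
    congr 1
    omega
  · rw [List.getElem_append_right (by simpa using h1)]
    simp only [List.length_reverse, length_wordPrefix]
    obtain ⟨k, rfl⟩ := Nat.exists_eq_add_of_le h1
    simp only [Nat.add_sub_cancel_left]
    match k with
    | 0 =>
      change s (-1) = _
      congr 1
      omega
    | 1 =>
      change s 0 = _
      congr 1
      omega
    | k + 2 =>
      simp only [List.cons_append, List.nil_append, List.getElem_cons_succ, wordPrefix,
        List.getElem_map, List.getElem_range]
      congr 1
      omega

lemma IsBalanced.isCentralLanguage {s : ℤ → Bool} (hs : IsBalanced s)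
    (hfac : HasCentralFactorization s) :
    IsCentralLanguage (fun u => IsFactor s u ∨ IsFactor s u.reverse)
      (fun n => s (n + 1)) where
  of_infix x y z h := by
    refine h.imp IsFactor.of_infix fun h => ?_
    refine IsFactor.of_infix (x := z.reverse) (z := x.reverse) ?_
    simpa using h
  reverse x h := by simpa using h.symm
  balanced t h1 h2 := by
    have key (u v : List Bool) (hu : IsFactor s u) (hv : IsFactor s v)
        (hl : u.length = v.length) (hc : u.count true + 2 = v.count true) : False := by
      have := hs u v hu hv hl true
      rw [← hc] at this
      simp at this
    rcases h1 with h1 | h1 <;> rcases h2 with h2 | h2 <;> exact key _ _ h1 h2 (by simp) (by simp)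
  central i j := by
    have h1 := hfac.1
    rcases ha : s (-1) with _ | _ <;> rcases hb : s 0 with _ | _
    · exact absurd (ha.trans hb.symm) h1
    · left
      simpa [ha, hb] using isFactor_central hfac i j
    · right
      simpa [ha, hb] using isFactor_central hfac j i
    · exact absurd (ha.trans hb.symm) h1

theorem muq12_strict_mono_on_central_balanced_language
    (s : ℤ → Bool) (hs : IsBalanced s) (hfac : HasCentralFactorization s)
    (u v : List Bool) (hu : IsFactor s u) (hv : IsFactor s v)
    (huv : RadixLt u v) :
    PolyPrec (muq u 0 1) (muq v 0 1) := by
  have h := hs.isCentralLanguage hfac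
  rcases huv with hl | ⟨hl, hlt⟩
  · exact polyPrec_of_coeffPos_sub
      (h.muq_sub_pos_of_length_lt (Or.inl hu) (Or.inl hv) hl)
  · exact polyPrec_of_coeffPos_sub
      (h.muq_sub_pos_of_lt (Or.inl hu) (Or.inl hv) hl (List.lex_lt.1 hlt))
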